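/- For every sequence gamma in {1,2}^N such that the concatenated sequence 1_2 2_2 1_2 gamma contains no word of P as a consecutive subword, the real number [overline(2_4 1_2 2_2 1)] + [0; 1, 2_2, 1_2, 2_4, 1, 2_2, 1_2, 2_2, 1_2, gamma] belongs to (M \ L) ∩ (3.118120178159, 3.118120178173). -/

import Mathlib

open Filter Set

/-- Convergents of the continued fraction `[a 0; a 1, a 2, ...]`. -/
noncomputable def cfConv : (ℕ → ℕ) → ℕ → ℝ
  | a, 0 => (a 0 : ℝ)
  | a, n + 1 => (a 0 : ℝ) + 1 / cfConv (fun i => a (i + 1)) n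

/-- Value of the infinite continued fraction `[a 0; a 1, a 2, ...]`,
i.e. the limit of its convergents. -/
noncomputable def cfVal (a : ℕ → ℕ) : ℝ := limUnder atTop (cfConv a)

/-- Value of the infinite continued fraction `[0; g 0, g 1, g 2, ...]`. -/
noncomputable def cf0 (g : ℕ → ℕ) : ℝ :=
  cfVal (fun n => match n with | 0 => 0 | k + 1 => g k)

/-- `λ_i(A) = [a_i; a_{i+1}, ...] + [0; a_{i-1}, a_{i-2}, ...]` for a bi-infinite
sequence `A`. -/
noncomputable def lam (A : ℤ → ℕ) (i : ℤ) : ℝ :=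
  cfVal (fun n => A (i + n)) + cf0 (fun k => A (i - 1 - k))

/-- The Markov value `m(A) = sup_i λ_i(A)`. -/
noncomputable def markovVal (A : ℤ → ℕ) : ℝ := sSup (Set.range (lam A))

/-- The Lagrange value `ℓ(A) = limsup_{i → +∞} λ_i(A)`. -/
noncomputable def lagrangeVal (A : ℤ → ℕ) : ℝ := limsup (lam A) atTop

/-- The Markov spectrum (Perron's characterization). -/
def MarkovSpectrum : Set ℝ :=
  {x | ∃ A : ℤ → ℕ, (∀ n, 0 < A n) ∧ BddAbove (Set.range (lam A)) ∧ x = markovVal A}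

/-- The Lagrange spectrum (Perron's characterization). -/
def LagrangeSpectrum : Set ℝ :=
  {x | ∃ A : ℤ → ℕ, (∀ n, 0 < A n) ∧ IsBoundedUnder (· ≤ ·) atTop (lam A) ∧
    x = lagrangeVal A}

/-- The purely periodic one-sided sequence with period `w`. -/
def perSeq (w : List ℕ) : ℕ → ℕ := fun n => w.getD (n % w.length) 1

/-- The one-sided sequence beginning with the finite word `p` and continuing with `g`. -/
def catSeq (p : List ℕ) (g : ℕ → ℕ) : ℕ → ℕ :=
  fun n => if n < p.length then p.getD n 1 else g (n - p.length)

/-- The eventually periodic one-sided sequence with preperiod `p` and period `w`. -/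
def prePer (p w : List ℕ) : ℕ → ℕ := catSeq p (perSeq w)

/-- The periodic bi-infinite sequence with period `w`. -/
def perZ (w : List ℕ) : ℤ → ℕ := fun n => w.getD ((n % (w.length : ℤ)).toNat) 1

/-- `c_∞ = [overline(2_4 1_2 2_2 1)] + [0; overline(1 2_2 1_2 2_4)]`. -/
noncomputable def cInf : ℝ :=
  cfVal (perSeq [2,2,2,2,1,1,2,2,1]) + cf0 (perSeq [1,2,2,1,1,2,2,2,2])

/-- `C_∞ = [2; 1, 2_2, 1_2, 2_4, 1, 2_2, 1_2, 2_4, 1, 2_2, 1_2, 2_2, 1, 2_4, 1_2,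
overline(2_3 1_3)] + [0; 2_3, 1_2, 2_2, 1, 2_4, 1, overline(1_3 2_3)]`. -/
noncomputable def CInf : ℝ :=
  cfVal (prePer [2,1,2,2,1,1,2,2,2,2,1,2,2,1,1,2,2,2,2,1,2,2,1,1,2,2,1,2,2,2,2,1,1]
    [2,2,2,1,1,1]) +
  cf0 (prePer [2,2,2,1,1,2,2,1,2,2,2,2,1] [1,1,1,2,2,2])

/-- `f = [overline(2_4 1_2 2_2 1)] + [0; 1, 2_2, 1_2, 2_4, 1, 2_2, 1_2, 2_2, 1_2,
overline(2_3 1_3)]`. -/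
noncomputable def fV : ℝ :=
  cfVal (perSeq [2,2,2,2,1,1,2,2,1]) +
  cf0 (prePer [1,2,2,1,1,2,2,2,2,1,2,2,1,1,2,2,1,1] [2,2,2,1,1,1])

/-- `w` occurs in the bi-infinite sequence `A` starting at position `j`. -/
def occursAtZ (w : List ℕ) (A : ℤ → ℕ) (j : ℤ) : Prop :=
  ∀ i : ℕ, i < w.length → A (j + i) = w.getD i 0

/-- `w` occurs somewhere in the bi-infinite sequence `A`. -/
def occursInZ (w : List ℕ) (A : ℤ → ℕ) : Prop := ∃ j : ℤ, occursAtZ w A j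

/-- `w` occurs in the one-sided sequence `g` starting at position `k`. -/
def occursAtN (w : List ℕ) (g : ℕ → ℕ) (k : ℕ) : Prop :=
  ∀ i : ℕ, i < w.length → g (k + i) = w.getD i 0

/-- `w` occurs somewhere in the one-sided sequence `g`. -/
def occursInN (w : List ℕ) (g : ℕ → ℕ) : Prop := ∃ k : ℕ, occursAtN w g k

def W1 : List ℕ := [1,2,1]
def W2 : List ℕ := [2,2,1,2,2,2,1]
def W3 : List ℕ := [2,2,2,1,2,2,2]
def W4 : List ℕ := [2,2,2,2,2,1,2,2,1,1]
def W5 : List ℕ := [2,2,2,1,1,2,2,2,2,1,2,2,1,1,2,2,2]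
def W6 : List ℕ := [2,2,1,1,2,2,2,2,1,2,2,1,1,2,2,2,1]
def W7 : List ℕ := [1,1,2,2,1,1,2,2,2,2,1,2,2,1,1,2,2,2]
def W8 : List ℕ := [2,2,1,2,2,1,1,2,2,2,2,1,2,2,1,1,2,2,2,2,2]
def W9 : List ℕ := [1,2,2,1,2,2,1,1,2,2,2,2,1,2,2,1,1,2,2,2,2,1]
def W10 : List ℕ := [2,2,2,2,1,2,2,1,1,2,2,2,2,1,2,2,1,1,2,2,2,2,1,1]
def W11 : List ℕ := [2,2,2,2,1,2,2,1,1,2,2,2,2,1,2,2,1,1,2,2,2,2,1,2,2,1,2]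
def W12 : List ℕ := [1,2,2,2,2,1,2,2,1,1,2,2,2,2,1,2,2,1,1,2,2,2,2,1,2,2,1,1,1]
def W13 : List ℕ := [2,1,2,2,2,2,1,2,2,1,1,2,2,2,2,1,2,2,1,1,2,2,2,2,1,2,2,1,1,2,2]

/-- The list of the thirteen words `W_1, …, W_13`. -/
def Wall : List (List ℕ) := [W1,W2,W3,W4,W5,W6,W7,W8,W9,W10,W11,W12,W13]

/-- The words `W_1, …, W_13` together with the (0-based) position of their marked
digit `2^*`. -/
def markedW : List (List ℕ × ℕ) :=
  [(W1,1),(W2,3),(W3,4),(W4,4),(W5,8),(W6,7),(W7,9),(W8,10),(W9,11),(W10,12),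
   (W11,12),(W12,13),(W13,14)]

/-- The words `V_15, …, V_21` together with the (0-based) position of their marked
digit `2^*`. -/
def markedV : List (List ℕ × ℕ) :=
  [([1,1,2,2],2),
   ([2,2,1,2,2,1],3),
   ([2,2,2,2,1,2,2,1,2],3),
   ([1,2,2,2,2,1,2,2,1,1,1],4),
   ([1,2,2,2,2,1,2,2,1,1,2,2,1],4),
   ([2,1,2,2,2,2,1,2,2,1,1,2,2,2],5),
   ([1,1,1,2,2,2,2,1,2,2,1,1,2,2,2],6)]

/-- The word `2 1_2 2_4 1 2_2 1_2 2_3`. -/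
def spWord : List ℕ := [2,1,1,2,2,2,2,1,2,2,1,1,2,2,2]

/-- The set `P` of 27 forbidden words: `W_1, …, W_13`, their transposes, and
`2 1_2 2_4 1 2_2 1_2 2_3` together with its transpose. -/
def Pwords : List (List ℕ) := Wall ++ Wall.map List.reverse ++ [spWord, spWord.reverse]

/-- `g` contains no word of `P` as a consecutive subword. -/
def avoidsP (g : ℕ → ℕ) : Prop := ∀ w ∈ Pwords, ¬ occursInN w g

/-- The Cantor set `Y`. -/
noncomputable def Yset : Set ℝ :=
  {x | ∃ g : ℕ → ℕ, (∀ n, g n = 1 ∨ g n = 2) ∧ avoidsP g ∧ x = cf0 g}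

/-- The word `1_2 2_4 1 2_2 1_2 2_4 1 2_2 1_2 2_4 1 2_2 1_2 2_2`. -/
def bigWord : List ℕ :=
  [1,1,2,2,2,2,1,2,2,1,1,2,2,2,2,1,2,2,1,1,2,2,2,2,1,2,2,1,1,2,2]

/-- The word `1_3 2_4 1 2_2 1_2 2_4 1 2_2 1_2 2_4 1 2_2 1_2 2_2`. -/
def bigWord13 : List ℕ := 1 :: bigWord

/-- `g` is an infinite concatenation of the blocks `(1,1)` and `(2,2)`. -/
def isBlockSeq (g : ℕ → ℕ) : Prop :=
  ∀ n, (g (2*n) = 1 ∧ g (2*n+1) = 1) ∨ (g (2*n) = 2 ∧ g (2*n+1) = 2)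

/-- The Gauss–Cantor set `K({1_2, 2_2})`. -/
noncomputable def Kset : Set ℝ := {x | ∃ g : ℕ → ℕ, isBlockSeq g ∧ x = cf0 g}


/-! ### Continued fractions with positive partial quotients -/

theorem le_cfConv {a : ℕ → ℕ} (h : ∀ n, 0 < a n) (n : ℕ) :
    (a 0 : ℝ) ≤ cfConv a n ∧ cfConv a n ≤ a 0 + 1 := by
  induction n generalizing a with
  | zero => simp [cfConv]
  | succ n ih =>
    have h1 := (ih (a := fun i => a (i + 1)) fun n => h _).1
    have h2 : (1 : ℝ) ≤ (a (0 + 1) : ℕ) := by exact_mod_cast h (0 + 1)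
    have h3 : 1 ≤ cfConv (fun i => a (i + 1)) n := h2.trans h1
    have h4 : 1 / cfConv (fun i => a (i + 1)) n ≤ 1 := by
      rw [div_le_one (by linarith)]; exact h3
    have h5 : 0 ≤ 1 / cfConv (fun i => a (i + 1)) n := by positivity
    simp only [cfConv]
    constructor <;> linarith

theorem one_le_cfConv {a : ℕ → ℕ} (h : ∀ n, 0 < a n) (n : ℕ) : 1 ≤ cfConv a n :=
  le_trans (by exact_mod_cast h 0) (le_cfConv h n).1

theorem abs_two_step_le {b x y : ℝ} (hb : 1 ≤ b) (hx : 1 ≤ x) (hy : 1 ≤ y) :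
    |1 / (b + 1 / x) - 1 / (b + 1 / y)| ≤ |x - y| / 4 := by
  have hx0 : 0 < x := by linarith
  have hy0 : 0 < y := by linarith
  have h1 : 2 ≤ b * x + 1 := by nlinarith
  have h2 : 2 ≤ b * y + 1 := by nlinarith
  have h3 : 1 / (b + 1 / x) - 1 / (b + 1 / y) = (x - y) / ((b * x + 1) * (b * y + 1)) := by
    have : b + 1 / x = (b * x + 1) / x := by field_simp
    have : b + 1 / y = (b * y + 1) / y := by field_simp
    have : b * x + 1 ≠ 0 := by linarith
    have : b * y + 1 ≠ 0 := by linarith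
    simp only [*, one_div_div]
    field_simp
    ring
  rw [h3, abs_div]
  have h4 : 4 ≤ |(b * x + 1) * (b * y + 1)| := by
    rw [abs_of_nonneg (by nlinarith)]; nlinarith
  gcongr

theorem abs_cfConv_sub_le (k : ℕ) {a : ℕ → ℕ} (h : ∀ n, 0 < a n) {n m : ℕ}
    (hn : 2 * k ≤ n) (hm : 2 * k ≤ m) : |cfConv a n - cfConv a m| ≤ (1 / 4) ^ k := by
  induction k generalizing a n m with
  | zero =>
    have h1 := le_cfConv h n
    have h2 := le_cfConv h m
    rw [pow_zero, abs_le]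
    constructor <;> linarith
  | succ k ih =>
    obtain ⟨n, rfl⟩ : ∃ n', n = n' + 2 := ⟨n - 2, by omega⟩
    obtain ⟨m, rfl⟩ : ∃ m', m = m' + 2 := ⟨m - 2, by omega⟩
    have h1 := ih (a := fun i => a (i + 2)) (fun n => h _) (n := n) (m := m)
      (by omega) (by omega)
    have h2 := abs_two_step_le (b := a 1) (by exact_mod_cast h 1)
      (one_le_cfConv (a := fun i => a (i + 2)) (fun n => h _) n)
      (one_le_cfConv (a := fun i => a (i + 2)) (fun n => h _) m)
    simp only [cfConv, add_sub_add_left_eq_sub, zero_add, pow_succ]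
    simp only [add_assoc, Nat.reduceAdd]
    linarith

theorem tendsto_cfConv {a : ℕ → ℕ} (h : ∀ n, 0 < a n) :
    Tendsto (cfConv a) atTop (nhds (cfVal a)) := by
  have hc : CauchySeq (cfConv a) := by
    rw [Metric.cauchySeq_iff]
    intro ε hε
    obtain ⟨k, hk⟩ := exists_pow_lt_of_lt_one hε (show (1 / 4 : ℝ) < 1 by norm_num)
    exact ⟨2 * k, fun m hm n hn => lt_of_le_of_lt (abs_cfConv_sub_le k h hm hn) hk⟩
  exact hc.tendsto_limUnder

theorem cfVal_mem {a : ℕ → ℕ} (h : ∀ n, 0 < a n) :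
    (a 0 : ℝ) ≤ cfVal a ∧ cfVal a ≤ a 0 + 1 :=
  ⟨ge_of_tendsto' (tendsto_cfConv h) fun n => (le_cfConv h n).1,
    le_of_tendsto' (tendsto_cfConv h) fun n => (le_cfConv h n).2⟩

theorem cfVal_succ {a : ℕ → ℕ} (h : ∀ n, 0 < a (n + 1)) :
    cfVal a = a 0 + 1 / cfVal (fun n => a (n + 1)) := by
  have h0 : (0 : ℝ) < cfVal (fun n => a (n + 1)) :=
    lt_of_lt_of_le (by exact_mod_cast h 0) (cfVal_mem h).1
  have h1 : Tendsto (fun n => cfConv a (n + 1)) atTop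
      (nhds (a 0 + 1 / cfVal (fun n => a (n + 1)))) := by
    simp only [cfConv, one_div]
    exact ((tendsto_cfConv h).inv₀ h0.ne').const_add _
  exact Tendsto.limUnder_eq ((tendsto_add_atTop_iff_nat 1).1 h1)

theorem cf0_eq {g : ℕ → ℕ} (h : ∀ n, 0 < g n) : cf0 g = 1 / cfVal g := by
  rw [cf0, cfVal_succ (fun n => h n)]
  simp

theorem cfVal_eq {a : ℕ → ℕ} (h : ∀ n, 0 < a n) :
    cfVal a = a 0 + cf0 (fun n => a (n + 1)) := by
  rw [cfVal_succ fun n => h _, cf0_eq fun n => h _]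

theorem cf0_succ {g : ℕ → ℕ} (h : ∀ n, 0 < g n) :
    cf0 g = 1 / (g 0 + cf0 (fun n => g (n + 1))) := by
  rw [cf0_eq h, cfVal_eq h]

theorem cf0_mem {g : ℕ → ℕ} (h : ∀ n, 0 < g n) : 0 ≤ cf0 g ∧ cf0 g ≤ 1 := by
  have h1 : (1 : ℝ) ≤ cfVal g := le_trans (by exact_mod_cast h 0) (cfVal_mem h).1
  rw [cf0_eq h]
  exact ⟨by positivity, (div_le_one (by linarith)).2 h1⟩

theorem lam_eq {A : ℤ → ℕ} (h : ∀ n, 0 < A n) (i : ℤ) :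
    lam A i = A i + cf0 (fun k => A (i + 1 + k)) + cf0 (fun k => A (i - 1 - k)) := by
  rw [lam, cfVal_eq fun n => h _]
  simp [add_assoc, add_comm (1 : ℤ)]

theorem lam_neg {A : ℤ → ℕ} (h : ∀ n, 0 < A n) (i : ℤ) :
    lam (fun n => A (-n)) i = lam A (-i) := by
  rw [lam_eq (fun n => h _), lam_eq h, add_right_comm]
  congr 4 <;> funext k <;> congr 1 <;> ring

/-! ### Bounds for `lam` on a window -/

/-- Lower and upper bounds, each a numerator and a denominator, for `cf0 g` when `g` starts
with the given word. -/
def cfBd : List ℕ → (ℕ × ℕ) × (ℕ × ℕ)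
  | [] => ((0, 1), (1, 1))
  | a :: l => match cfBd l with
    | ((p, q), (r, s)) => ((s, a * s + r), (q, a * q + p))

/-- The word `l` is a prefix of `g`. -/
def Agree (l : List ℕ) (g : ℕ → ℕ) : Prop := ∀ k a, l[k]? = some a → g k = a

theorem Agree.tail {a : ℕ} {l : List ℕ} {g : ℕ → ℕ} (h : Agree (a :: l) g) :
    Agree l fun n => g (n + 1) := fun k b hb => h (k + 1) b (by simpa using hb)

theorem Agree.head {a : ℕ} {l : List ℕ} {g : ℕ → ℕ} (h : Agree (a :: l) g) : g 0 = a :=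
  h 0 a (by simp)

theorem Agree.mono {l m : List ℕ} {g : ℕ → ℕ} (h : Agree m g) (hl : l <+: m) :
    Agree l g := by
  obtain ⟨t, rfl⟩ := hl
  intro k a hk
  exact h k a (by rw [List.getElem?_append_left (List.getElem?_eq_some_iff.1 hk).1]; exact hk)

theorem Agree.append {l : List ℕ} {g : ℕ → ℕ} {a : ℕ} (h : Agree l g) (ha : g l.length = a) :
    Agree (l ++ [a]) g := by
  intro k b hk
  rcases lt_trichotomy k l.length with hl | rfl | hl
  · exact h k b (by rwa [List.getElem?_append_left hl] at hk)
  · simpa [ha] using hk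
  · rw [List.getElem?_eq_none (by simp; omega)] at hk
    cases hk

theorem cfBd_spec (l : List ℕ) {g : ℕ → ℕ} (hg : ∀ n, 0 < g n) (h : Agree l g) :
    0 < (cfBd l).1.2 ∧ 0 < (cfBd l).2.2 ∧
      ((cfBd l).1.1 / (cfBd l).1.2 : ℝ) ≤ cf0 g ∧ cf0 g ≤ (cfBd l).2.1 / (cfBd l).2.2 := by
  induction l generalizing g with
  | nil => simpa [cfBd] using cf0_mem hg
  | cons a l ih =>
    have ht := ih (fun n => hg (n + 1)) h.tail
    have ha : 0 < a := h.head ▸ hg 0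
    have h0 := cf0_mem fun n => hg (n + 1)
    rw [cf0_succ hg, h.head]
    simp only [cfBd]
    rcases hb : cfBd l with ⟨⟨p, q⟩, ⟨r, s⟩⟩
    rw [hb] at ht
    simp only at ht ⊢
    obtain ⟨hq, hs, h1, h2⟩ := ht
    have ha' : (0 : ℝ) < a := by exact_mod_cast ha
    have hq' : (0 : ℝ) < q := by exact_mod_cast hq
    have hs' : (0 : ℝ) < s := by exact_mod_cast hs
    refine ⟨by positivity, by positivity, ?_, ?_⟩
    · have : (s : ℝ) / (a * s + r : ℕ) = 1 / (a + r / s) := by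
        push_cast; field_simp
      rw [this]
      exact one_div_le_one_div_of_le (by linarith) (by linarith)
    · have : (q : ℝ) / (a * q + p : ℕ) = 1 / (a + p / q) := by
        push_cast; field_simp
      rw [this]
      exact one_div_le_one_div_of_le (by positivity) (by linarith)

/-- Around the position `i`, the sequence `A` reads `L.reverse, c, R`. -/
structure Win (A : ℤ → ℕ) (i : ℤ) (L : List ℕ) (c : ℕ) (R : List ℕ) : Prop where
  center : A i = c
  left : Agree L fun k => A (i - 1 - k)
  right : Agree R fun k => A (i + 1 + k)

/-- Every `lam` value at the centre of the window is below `t / 10 ^ 12`. -/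
def lamLt (t : ℕ) (L : List ℕ) (c : ℕ) (R : List ℕ) : Bool :=
  match (cfBd L).2, (cfBd R).2 with
  | (p, q), (r, s) => Nat.blt (10 ^ 12 * (c * (q * s) + p * s + r * q)) (t * (q * s))

/-- Every `lam` value at the centre of the window is above `t / 10 ^ 12`. -/
def lamGt (t : ℕ) (L : List ℕ) (c : ℕ) (R : List ℕ) : Bool :=
  match (cfBd L).1, (cfBd R).1 with
  | (p, q), (r, s) => Nat.blt (t * (q * s)) (10 ^ 12 * (c * (q * s) + p * s + r * q))

theorem Win.lt_of_lamLt {A : ℤ → ℕ} (hA : ∀ n, 0 < A n) {i : ℤ} {L R : List ℕ} {c t : ℕ}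
    (hw : Win A i L c R) (h : lamLt t L c R = true) : lam A i < t / 10 ^ 12 := by
  have h1 := cfBd_spec L (fun k => hA _) hw.left
  have h2 := cfBd_spec R (fun k => hA _) hw.right
  unfold lamLt at h
  rw [lam_eq hA, hw.center]
  generalize cfBd L = x at h h1
  generalize cfBd R = y at h h2
  obtain ⟨⟨p', q'⟩, ⟨p, q⟩⟩ := x
  obtain ⟨⟨r', s'⟩, ⟨r, s⟩⟩ := y
  simp only [Nat.blt_eq] at h h1 h2
  have h' : (10 ^ 12 * (c * (q * s) + p * s + r * q) : ℝ) < t * (q * s) := by exact_mod_cast h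
  have hq : (0 : ℝ) < q := by exact_mod_cast h1.2.1
  have hs : (0 : ℝ) < s := by exact_mod_cast h2.2.1
  have h3 : (c + r / s + p / q : ℝ) < t / 10 ^ 12 := by
    have : (c + r / s + p / q : ℝ) = (c * (q * s) + p * s + r * q) / (q * s) := by
      field_simp; ring
    rw [this, div_lt_div_iff₀ (by positivity) (by positivity)]
    linarith
  linarith [h1.2.2.2, h2.2.2.2]

theorem Win.gt_of_lamGt {A : ℤ → ℕ} (hA : ∀ n, 0 < A n) {i : ℤ} {L R : List ℕ} {c t : ℕ}
    (hw : Win A i L c R) (h : lamGt t L c R = true) : t / 10 ^ 12 < lam A i := by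
  have h1 := cfBd_spec L (fun k => hA _) hw.left
  have h2 := cfBd_spec R (fun k => hA _) hw.right
  unfold lamGt at h
  rw [lam_eq hA, hw.center]
  generalize cfBd L = x at h h1
  generalize cfBd R = y at h h2
  obtain ⟨⟨p, q⟩, ⟨p', q'⟩⟩ := x
  obtain ⟨⟨r, s⟩, ⟨r', s'⟩⟩ := y
  simp only [Nat.blt_eq] at h h1 h2
  have h' : (t * (q * s) : ℝ) < 10 ^ 12 * (c * (q * s) + p * s + r * q) := by exact_mod_cast h
  have hq : (0 : ℝ) < q := by exact_mod_cast h1.1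
  have hs : (0 : ℝ) < s := by exact_mod_cast h2.1
  have h3 : (t / 10 ^ 12 : ℝ) < c + r / s + p / q := by
    have : (c + r / s + p / q : ℝ) = (c * (q * s) + p * s + r * q) / (q * s) := by
      field_simp; ring
    rw [this, div_lt_div_iff₀ (by positivity) (by positivity)]
    linarith
  linarith [h1.2.2.1, h2.2.2.1]

theorem Win.mono {A : ℤ → ℕ} {i : ℤ} {L L' R R' : List ℕ} {c : ℕ} (h : Win A i L' c R')
    (hL : L <+: L') (hR : R <+: R') : Win A i L c R :=
  ⟨h.center, h.left.mono hL, h.right.mono hR⟩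

theorem Win.swap {A : ℤ → ℕ} {i : ℤ} {L R : List ℕ} {c : ℕ} (h : Win A i L c R) :
    Win (fun n => A (-n)) (-i) R c L := by
  refine ⟨by simpa using h.center, fun k a hk => ?_, fun k a hk => ?_⟩
  · rw [← h.right k a hk]; beta_reduce; congr 1; ring
  · rw [← h.left k a hk]; beta_reduce; congr 1; ring

theorem Win.shiftRight {A : ℤ → ℕ} {i : ℤ} {L R : List ℕ} {c d : ℕ}
    (h : Win A i L c (d :: R)) : Win A (i + 1) (c :: L) d R := by
  refine ⟨by simpa using h.right.head, fun k a hk => ?_, fun k a hk => ?_⟩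
  · cases k with
    | zero =>
      have : c = a := by simpa using hk
      rw [← this, ← h.center]; beta_reduce; congr 1; simp
    | succ k =>
      rw [← h.left k a (by simpa using hk)]; beta_reduce; congr 1; push_cast; ring
  · rw [← h.right (k + 1) a (by simpa using hk)]; beta_reduce; congr 1; push_cast; ring

theorem Win.shiftLeft {A : ℤ → ℕ} {i : ℤ} {L R : List ℕ} {c d : ℕ}
    (h : Win A i (d :: L) c R) : Win A (i - 1) L d (c :: R) := by
  refine ⟨by simpa using h.left.head, fun k a hk => ?_, fun k a hk => ?_⟩
  · rw [← h.left (k + 1) a (by simpa using hk)]; beta_reduce; congr 1; push_cast; ring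
  · cases k with
    | zero =>
      have : c = a := by simpa using hk
      rw [← this, ← h.center]; beta_reduce; congr 1; simp
    | succ k =>
      rw [← h.right k a (by simpa using hk)]; beta_reduce; congr 1; push_cast; ring

theorem Win.of_eq {A : ℤ → ℕ} {i : ℤ} {m n : ℕ} (K : ℤ → ℕ)
    (h : ∀ t : ℤ, -m ≤ t → t ≤ n → A (i + t) = K t) :
    Win A i ((List.range m).map fun k : ℕ => K (-1 - k)) (K 0)
      ((List.range n).map fun k : ℕ => K (1 + k)) := by
  refine ⟨by simpa using h 0 (by omega) (by omega), fun k a hk => ?_, fun k a hk => ?_⟩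
  · simp only [List.getElem?_map, Option.map_eq_some_iff, List.getElem?_eq_some_iff] at hk
    obtain ⟨b, ⟨hb, rfl⟩, rfl⟩ := hk
    simp only [List.length_range] at hb
    simp only [List.getElem_range]
    rw [← h _ (by omega) (by omega)]; congr 1; ring
  · simp only [List.getElem?_map, Option.map_eq_some_iff, List.getElem?_eq_some_iff] at hk
    obtain ⟨b, ⟨hb, rfl⟩, rfl⟩ := hk
    simp only [List.length_range] at hb
    simp only [List.getElem_range]
    rw [← h _ (by omega) (by omega)]; congr 1; ring

/-! ### Exhaustive search over windows -/

/-- Does some shift of the window to the right pass the test `f`? -/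
def scanRight (f : List ℕ → ℕ → List ℕ → Bool) (L : List ℕ) (c : ℕ) : List ℕ → Bool
  | [] => f L c []
  | d :: R => f L c (d :: R) || scanRight f (c :: L) d R

/-- Does some shift of the window to the left pass the test `f`? -/
def scanLeft (f : List ℕ → ℕ → List ℕ → Bool) (c : ℕ) (R : List ℕ) : List ℕ → Bool
  | [] => f [] c R
  | d :: L => f (d :: L) c R || scanLeft f d (c :: R) L

theorem Win.scanRight_eq {f : List ℕ → ℕ → List ℕ → Bool} {A : ℤ → ℕ} {a b i : ℤ}
    (H : ∀ j L c R, a ≤ j → j ≤ b → Win A j L c R → f L c R = false)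
    {L R : List ℕ} {c : ℕ} (hw : Win A i L c R) (ha : a ≤ i) (hb : i + R.length ≤ b) :
    scanRight f L c R = false := by
  induction R generalizing i L c with
  | nil => exact H _ _ _ _ ha (by simpa using hb) hw
  | cons d R ih =>
    simp only [List.length_cons] at hb
    push_cast at hb
    simp only [scanRight, Bool.or_eq_false_iff]
    exact ⟨H _ _ _ _ ha (by omega) hw, ih hw.shiftRight (by omega) (by omega)⟩

theorem Win.scanLeft_eq {f : List ℕ → ℕ → List ℕ → Bool} {A : ℤ → ℕ} {a b i : ℤ}
    (H : ∀ j L c R, a ≤ j → j ≤ b → Win A j L c R → f L c R = false)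
    {L R : List ℕ} {c : ℕ} (hw : Win A i L c R) (ha : a ≤ i - L.length) (hb : i ≤ b) :
    scanLeft f c R L = false := by
  induction L generalizing i R c with
  | nil => exact H _ _ _ _ (by simpa using ha) hb hw
  | cons d L ih =>
    simp only [List.length_cons] at ha
    push_cast at ha
    simp only [scanLeft, Bool.or_eq_false_iff]
    exact ⟨H _ _ _ _ (by omega) hb hw, ih hw.shiftLeft (by omega) (by omega)⟩

/-- Are all extensions of the window by digits `1` and `2`, with at most `n` new digits,
eventually discarded by `f`? -/
def search (f : List ℕ → ℕ → List ℕ → Bool) : ℕ → List ℕ → ℕ → List ℕ → Bool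
  | 0, L, c, R => f L c R
  | n + 1, L, c, R => f L c R ||
    bif Nat.ble L.length R.length then
      search f n (L ++ [1]) c R && search f n (L ++ [2]) c R
    else search f n L c (R ++ [1]) && search f n L c (R ++ [2])

theorem Win.search_eq {f : List ℕ → ℕ → List ℕ → Bool} {A : ℤ → ℕ} {a b i : ℤ}
    (hd : ∀ j, a ≤ j → j ≤ b → A j = 1 ∨ A j = 2)
    (H : ∀ L c R, a ≤ i - (L.length : ℤ) → i + (R.length : ℤ) ≤ b → Win A i L c R →
      f L c R = false)
    {n : ℕ} {L R : List ℕ} {c : ℕ} (hw : Win A i L c R)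
    (ha : a ≤ i - L.length - n) (hb : i + R.length + n ≤ b) : search f n L c R = false := by
  induction n generalizing L R with
  | zero => exact H _ _ _ (by simpa using ha) (by simpa using hb) hw
  | succ n ih =>
    push_cast at ha hb
    simp only [search, Bool.or_eq_false_iff]
    refine ⟨H _ _ _ (by omega) (by omega) hw, ?_⟩
    rcases Nat.ble L.length R.length with _ | _
    · have key : ∀ e, A (i + 1 + R.length) = e → search f n L c (R ++ [e]) = false :=
        fun e he => ih ⟨hw.center, hw.left, hw.right.append he⟩ (by omega)
          (by simp only [List.length_append, List.length_singleton]; push_cast; omega)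
      simp only [cond_false, Bool.and_eq_false_iff]
      exact (hd (i + 1 + R.length) (by omega) (by omega)).imp (key 1) (key 2)
    · have key : ∀ e, A (i - 1 - L.length) = e → search f n (L ++ [e]) c R = false :=
        fun e he => ih ⟨hw.center, hw.left.append he, hw.right⟩
          (by simp only [List.length_append, List.length_singleton]; push_cast; omega)
          (by omega)
      simp only [cond_true, Bool.and_eq_false_iff]
      exact (hd (i - 1 - L.length) (by omega) (by omega)).imp (key 1) (key 2)

/-! ### Sequences whose `lam` values stay below the window -/

/-- Numerator over `10 ^ 12` of the lower end of the interval. -/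
def tLow : ℕ := 3118120178159

/-- Numerator over `10 ^ 12` of the upper end of the interval. -/
def tHigh : ℕ := 3118120178173

/-- The period. -/
def perWord : List ℕ := [2,2,2,2,1,1,2,2,1]

/-- The word read leftwards from a marked position. -/
def leftWord : List ℕ := [1,2,2,1,1,2,2,2,2,1]

/-- The word read rightwards from a marked position. -/
def rightWord : List ℕ := [2,2,2,1,1,2]

/-- The forced extension of `rightWord`. -/
def longRightWord : List ℕ := [2,2,2,1,1,2,2,1,2,2,2,2,1,1,2]

/-- On `[a, b]` the digits are `1` or `2` and the values `lam A` stay below the upper end of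
the interval. -/
structure Good (A : ℤ → ℕ) (a b : ℤ) : Prop where
  pos : ∀ n, 0 < A n
  digit : ∀ j, a ≤ j → j ≤ b → A j = 1 ∨ A j = 2
  lam_lt : ∀ j, a ≤ j → j ≤ b → lam A j < tHigh / 10 ^ 12

theorem Good.neg {A : ℤ → ℕ} {a b : ℤ} (h : Good A a b) :
    Good (fun n => A (-n)) (-b) (-a) :=
  ⟨fun _ => h.pos _, fun j h1 h2 => h.digit _ (by omega) (by omega), fun j h1 h2 => by
    rw [lam_neg h.pos]; exact h.lam_lt _ (by omega) (by omega)⟩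

theorem Good.lamGt_eq {A : ℤ → ℕ} {a b : ℤ} (h : Good A a b) (j : ℤ) (L : List ℕ) (c : ℕ)
    (R : List ℕ) (ha : a ≤ j) (hb : j ≤ b) (hw : Win A j L c R) :
    lamGt tHigh L c R = false := by
  by_contra hc
  exact lt_asymm (h.lam_lt j ha hb) (hw.gt_of_lamGt h.pos (by simpa using hc))

/-- Some digit of the window has a `lam` value above the upper end of the interval. -/
def tooLarge (L : List ℕ) (c : ℕ) (R : List ℕ) : Bool :=
  scanRight (lamGt tHigh) L c R || scanLeft (lamGt tHigh) c R L

theorem Good.tooLarge_eq {A : ℤ → ℕ} {a b i : ℤ} (h : Good A a b) {L R : List ℕ} {c : ℕ}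
    (hw : Win A i L c R) (ha : a ≤ i - L.length) (hb : i + R.length ≤ b) :
    tooLarge L c R = false := by
  rw [tooLarge, hw.scanRight_eq h.lamGt_eq (by omega) hb, hw.scanLeft_eq h.lamGt_eq ha (by omega)]
  rfl

/-- The window extends the given one. -/
def extendsWin (L' R' L R : List ℕ) : Bool := L'.isPrefixOf L && R'.isPrefixOf R

theorem Win.of_extendsWin {A : ℤ → ℕ} {i : ℤ} {L L' R R' : List ℕ} {c : ℕ}
    (hw : Win A i L c R) (h : extendsWin L' R' L R = true) : Win A i L' c R' := by
  simp [extendsWin] at h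
  exact hw.mono h.1 h.2

theorem search_center :
    search (fun L c R => lamLt tLow L c R || extendsWin leftWord rightWord L R ||
      extendsWin rightWord leftWord L R || tooLarge L c R) 21 [] 2 [] = true := by
  decide +kernel

theorem lamLt_one : lamLt tLow [] 1 [] = true := by decide +kernel

theorem search_extend :
    search (fun L c R => extendsWin leftWord longRightWord L R || tooLarge L c R) 16
      leftWord 2 rightWord = true := by
  decide +kernel

theorem Win.of_eq_nil {A : ℤ → ℕ} {i : ℤ} {c : ℕ} (h : A i = c) : Win A i [] c [] :=
  ⟨h, fun k a hk => by simp at hk, fun k a hk => by simp at hk⟩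

theorem Good.center {A : ℤ → ℕ} {a b j : ℤ} (h : Good A a b) (ha : a + 30 ≤ j) (hb : j + 30 ≤ b)
    (hj : tLow / 10 ^ 12 < lam A j) :
    Win A j leftWord 2 rightWord ∨ Win A j rightWord 2 leftWord := by
  by_contra hc
  rw [not_or] at hc
  rcases h.digit j (by omega) (by omega) with h1 | h2
  · exact lt_asymm hj ((Win.of_eq_nil h1).lt_of_lamLt h.pos lamLt_one)
  · refine Bool.false_ne_true (((Win.of_eq_nil h2).search_eq h.digit (fun L c R hL hR hw => ?_)
      ?_ ?_).symm.trans search_center)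
    · obtain rfl : c = 2 := hw.center.symm.trans h2
      simp only [Bool.or_eq_false_iff, h.tooLarge_eq hw hL hR, and_true]
      exact ⟨⟨Bool.eq_false_of_not_eq_true fun hn => lt_asymm hj (hw.lt_of_lamLt h.pos hn),
        Bool.eq_false_of_not_eq_true fun hn => hc.1 (hw.of_extendsWin hn)⟩,
        Bool.eq_false_of_not_eq_true fun hn => hc.2 (hw.of_extendsWin hn)⟩
    · simp only [List.length_nil]; omega
    · simp only [List.length_nil]; omega

theorem Good.extend {A : ℤ → ℕ} {a b p : ℤ} (h : Good A a b) (ha : a + 30 ≤ p) (hb : p + 40 ≤ b)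
    (hp : Win A p leftWord 2 rightWord) : Win A p leftWord 2 longRightWord := by
  by_contra hc
  refine Bool.false_ne_true ((hp.search_eq h.digit (fun L c R hL hR hw => ?_)
    ?_ ?_).symm.trans search_extend)
  · obtain rfl : c = 2 := hw.center.symm.trans hp.center
    simp only [Bool.or_eq_false_iff, h.tooLarge_eq hw hL hR, and_true]
    exact Bool.eq_false_of_not_eq_true fun hn => hc (hw.of_extendsWin hn)
  · simp only [leftWord, List.length_cons, List.length_nil]; omega
  · simp only [rightWord, List.length_cons, List.length_nil]; omega

theorem Good.next {A : ℤ → ℕ} {a b p : ℤ} (h : Good A a b) (ha : a + 30 ≤ p) (hb : p + 40 ≤ b)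
    (hp : Win A p leftWord 2 rightWord) : Win A (p + 9) leftWord 2 rightWord := by
  have h1 := (h.extend ha hb hp).shiftRight.shiftRight.shiftRight.shiftRight.shiftRight.shiftRight
    |>.shiftRight.shiftRight.shiftRight
  simp only [add_assoc, Int.reduceAdd] at h1
  exact h1.mono (by decide) (by decide)

theorem Good.iterate {A : ℤ → ℕ} {a b p : ℤ} (h : Good A a b) (ha : a + 30 ≤ p)
    (hp : Win A p leftWord 2 rightWord) (k : ℕ) (hb : p + 9 * k + 40 ≤ b) :
    Win A (p + 9 * k) leftWord 2 longRightWord := by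
  induction k with
  | zero => exact h.extend (by omega) (by omega) (by simpa using hp)
  | succ k ih =>
    push_cast at hb ⊢
    have h1 := (ih (by omega)).mono (List.prefix_refl _) (R := rightWord) (by decide)
    have h2 := h.next (by omega) (by omega) h1
    rw [show p + 9 * ((k : ℤ) + 1) = p + 9 * k + 9 by ring]
    exact h.extend (by omega) (by omega) h2

theorem perZ_perWord_emod (x : ℤ) : perZ perWord (x % 9) = perZ perWord x := by
  simp [perZ, perWord]

theorem Good.eq_perZ {A : ℤ → ℕ} {a b p j : ℤ} (h : Good A a b) (ha : a + 30 ≤ p)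
    (hp : Win A p leftWord 2 rightWord) (hj : p ≤ j) (hb : j + 60 ≤ b) :
    A j = perZ perWord (j - p) := by
  obtain ⟨k, hk⟩ : ∃ k : ℕ, (k : ℤ) = (j - p) / 9 := ⟨((j - p) / 9).toNat, by omega⟩
  obtain ⟨r, hr⟩ : ∃ r : ℕ, (r : ℤ) = (j - p) % 9 := ⟨((j - p) % 9).toNat, by omega⟩
  have hw := h.iterate ha hp k (by omega)
  rw [← perZ_perWord_emod, ← hr]
  have hr9 : r < 9 := by omega
  have hjk : j = p + 9 * k + r := by omega
  rcases r with _ | r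
  · rw [hjk, Nat.cast_zero, add_zero, hw.center]
    rfl
  · have h1 := hw.right r (longRightWord.getD r 0)
    rw [hjk, show p + 9 * (k : ℤ) + (r + 1 : ℕ) = p + 9 * k + 1 + r by push_cast; ring]
    have hr8 : r < 8 := by omega
    refine (h1 ?_).trans ?_ <;> interval_cases r <;> rfl

theorem lamLt_perZ : ∀ r < 9, lamLt tLow
    ((List.range 18).map fun k : ℕ => perZ perWord ((r : ℕ) + (-1 - k)))
    (perZ perWord (r + 0))
    ((List.range 18).map fun k : ℕ => perZ perWord (r + (1 + k))) = true := by
  decide +kernel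

theorem lam_lt_of_eq_perZ {A : ℤ → ℕ} (hA : ∀ n, 0 < A n) {p j : ℤ}
    (h : ∀ n, j - 18 ≤ n → n ≤ j + 18 → A n = perZ perWord (n - p)) :
    lam A j < tLow / 10 ^ 12 := by
  obtain ⟨r, hr⟩ : ∃ r : ℕ, (r : ℤ) = (j - p) % 9 := ⟨((j - p) % 9).toNat, by omega⟩
  refine (Win.of_eq (m := 18) (n := 18) (fun t => perZ perWord (r + t))
    fun t h1 h2 => ?_).lt_of_lamLt hA (lamLt_perZ r (by omega))
  rw [h _ (by push_cast at h1; omega) (by push_cast at h2; omega), ← perZ_perWord_emod,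
    ← perZ_perWord_emod (r + t)]
  congr 1
  omega

theorem Good.lam_lt_of_win {A : ℤ → ℕ} {a b p j : ℤ} (h : Good A a b) (ha : a + 30 ≤ p)
    (hp : Win A p leftWord 2 rightWord) (hj : p + 30 ≤ j) (hb : j + 100 ≤ b) :
    lam A j < tLow / 10 ^ 12 :=
  lam_lt_of_eq_perZ h.pos fun _ h1 h2 => h.eq_perZ ha hp (by omega) (by omega)

/-- If the values `lam A` eventually stay below the upper end of the interval, then they
eventually stay below its lower end. -/
theorem not_frequently_of_good {A : ℤ → ℕ} {a : ℤ} (h : ∀ b, Good A a b) :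
    ¬ ∃ᶠ j in atTop, (tLow / 10 ^ 12 : ℝ) < lam A j := by
  intro hf
  rw [frequently_atTop] at hf
  obtain ⟨p, hp, hp'⟩ := hf (a + 300)
  obtain ⟨q, hq, hq'⟩ := hf (p + 300)
  rcases (h (q + 30)).center (by omega) (by omega) hq' with hc | hc
  · obtain ⟨j, hj, hj'⟩ := hf (q + 30)
    exact lt_asymm hj' ((h (j + 100)).lam_lt_of_win (by omega) hc hj (by omega))
  · have h1 := (h (q + 30)).neg.lam_lt_of_win (by omega) hc.swap (j := -p) (by omega) (by omega)
    rw [lam_neg (h 0).pos, neg_neg] at h1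
    exact lt_asymm hp' h1

theorem digit_of_lam_lt {A : ℤ → ℕ} (hA : ∀ n, 0 < A n) {a : ℤ}
    (h : ∀ j, a ≤ j → lam A j < tHigh / 10 ^ 12) {j : ℤ} (hj : a ≤ j) : A j = 1 ∨ A j = 2 := by
  have hT : (tHigh / 10 ^ 12 : ℝ) < 13 / 4 := by norm_num [tHigh]
  have h3 : ∀ i, a ≤ i → A i ≤ 3 := by
    intro i hi
    have h1 := h i hi
    rw [lam_eq hA] at h1
    have h2 := (cf0_mem (g := fun k => A (i + 1 + k)) fun _ => hA _).1
    have h3 := (cf0_mem (g := fun k => A (i - 1 - k)) fun _ => hA _).1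
    have h4 : (A i : ℝ) < 4 := by linarith
    have h5 : A i < 4 := by exact_mod_cast h4
    omega
  have h0 := hA j
  by_contra hc
  have hj3 : A j = 3 := by have := h3 j hj; omega
  have h1 := h j hj
  rw [lam_eq hA, cf0_succ (g := fun k => A (j + 1 + k)) fun _ => hA _, hj3] at h1
  have h2 := (cf0_mem (g := fun k => A (j - 1 - k)) fun _ => hA _).1
  have h4 := cf0_mem (g := fun k => A (j + 1 + (k + 1 : ℕ))) fun _ => hA _
  have h5 : ((A (j + 1 + (0 : ℕ)) : ℕ) : ℝ) ≤ 3 := by exact_mod_cast h3 _ (by omega)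
  have h6 : (0 : ℝ) < (A (j + 1 + (0 : ℕ)) : ℕ) := by exact_mod_cast hA _
  have h7 := one_div_le_one_div_of_le
    (a := (A (j + 1 + (0 : ℕ)) : ℝ) + cf0 fun k => A (j + 1 + (k + 1 : ℕ))) (b := (4 : ℝ))
    (by linarith [h4.1]) (by linarith [h4.2])
  norm_num only [Nat.cast_ofNat] at h1 h7 hT
  linarith

theorem notMem_lagrangeSpectrum {x : ℝ} (h1 : tLow / 10 ^ 12 < x) (h2 : x < tHigh / 10 ^ 12) :
    x ∉ LagrangeSpectrum := by
  rintro ⟨B, hB, hb, rfl⟩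
  rw [lagrangeVal] at h1 h2
  have hpos : ∀ j, 0 ≤ lam B j := by
    intro j
    rw [lam_eq hB]
    have h2 := (cf0_mem (g := fun k => B (j + 1 + k)) fun _ => hB _).1
    have h3 := (cf0_mem (g := fun k => B (j - 1 - k)) fun _ => hB _).1
    positivity
  have hb' : IsCoboundedUnder (· ≤ ·) atTop (lam B) :=
    (isBoundedUnder_of ⟨0, hpos⟩ : IsBoundedUnder (· ≥ ·) atTop (lam B)).isCoboundedUnder_le
  obtain ⟨a, ha⟩ := eventually_atTop.1 (eventually_lt_of_limsup_lt h2 hb)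
  exact not_frequently_of_good (A := B) (a := a)
    (fun b => ⟨hB, fun j hj _ => digit_of_lam_lt hB ha hj, fun j hj _ => ha j hj⟩)
    (frequently_lt_of_lt_limsup hb' h1)

/-! ### The bi-infinite sequences realizing the family -/

/-- The fixed digits to the left of the position `0`, read leftwards. -/
def fixWord : List ℕ := [1,2,2,1,1,2,2,2,2,1,2,2,1,1,2,2,1,1]

/-- The digits that do not depend on the free tail. -/
def fixedDigit (n : ℤ) : ℕ := if 0 ≤ n then perZ perWord n else fixWord.getD (-n - 1).toNat 1

/-- The bi-infinite sequence with free left tail `γ`. -/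
def familySeq (γ : ℕ → ℕ) (n : ℤ) : ℕ :=
  if 0 ≤ n then perZ perWord n else catSeq fixWord γ (-n - 1).toNat

theorem perZ_perWord_digit (n : ℤ) : perZ perWord n = 1 ∨ perZ perWord n = 2 := by
  obtain ⟨r, hr⟩ : ∃ r : ℕ, (r : ℤ) = n % 9 := ⟨(n % 9).toNat, by omega⟩
  rw [← perZ_perWord_emod, ← hr]
  have : ∀ r < 9, perZ perWord (r : ℕ) = 1 ∨ perZ perWord (r : ℕ) = 2 := by decide
  exact this r (by omega)

theorem fixWord_digit : ∀ k < 18, fixWord.getD k 1 = 1 ∨ fixWord.getD k 1 = 2 := by decide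

theorem familySeq_of_nonneg (γ : ℕ → ℕ) {n : ℤ} (h : 0 ≤ n) :
    familySeq γ n = perZ perWord n := if_pos h

theorem familySeq_left (γ : ℕ → ℕ) (k : ℕ) : familySeq γ (-1 - k) = catSeq fixWord γ k := by
  rw [familySeq, if_neg (by omega)]
  congr 1
  omega

theorem familySeq_eq_fixedDigit (γ : ℕ → ℕ) {n : ℤ} (h : -18 ≤ n) :
    familySeq γ n = fixedDigit n := by
  unfold familySeq fixedDigit catSeq
  split_ifs with h1 h2
  · rfl
  · rfl
  · simp only [fixWord, List.length_cons, List.length_nil] at h2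
    omega

theorem familySeq_digit {γ : ℕ → ℕ} (hγ : ∀ n, γ n = 1 ∨ γ n = 2) (n : ℤ) :
    familySeq γ n = 1 ∨ familySeq γ n = 2 := by
  unfold familySeq catSeq
  split_ifs with h1 h2
  · exact perZ_perWord_digit n
  · exact fixWord_digit _ h2
  · exact hγ _

theorem familySeq_pos {γ : ℕ → ℕ} (hγ : ∀ n, γ n = 1 ∨ γ n = 2) (n : ℤ) : 0 < familySeq γ n := by
  rcases familySeq_digit hγ n with h | h <;> omega

theorem lam_familySeq_zero (γ : ℕ → ℕ) :
    lam (familySeq γ) 0 = cfVal (perSeq perWord) + cf0 (catSeq fixWord γ) := by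
  have h1 : (fun n : ℕ => familySeq γ (0 + n)) = perSeq perWord := by
    funext n
    rw [familySeq_of_nonneg _ (by omega), perZ, perSeq, zero_add, ← Int.natCast_mod,
      Int.toNat_natCast]
  have h2 : (fun k : ℕ => familySeq γ (0 - 1 - k)) = catSeq fixWord γ := by
    funext k
    rw [zero_sub, familySeq_left]
  rw [lam, h1, h2]

theorem familySeq_win (γ : ℕ → ℕ) {i : ℤ} {m n : ℕ} (h : -18 ≤ i - m) :
    Win (familySeq γ) i ((List.range m).map fun k : ℕ => fixedDigit (i + (-1 - k)))
      (fixedDigit (i + 0)) ((List.range n).map fun k : ℕ => fixedDigit (i + (1 + k))) :=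
  Win.of_eq (fun t => fixedDigit (i + t)) fun _ _ _ => familySeq_eq_fixedDigit γ (by omega)

theorem lamLt_zero : lamLt tHigh ((List.range 18).map fun k : ℕ => fixedDigit (0 + (-1 - k)))
    (fixedDigit (0 + 0)) ((List.range 40).map fun k : ℕ => fixedDigit (0 + (1 + k))) = true := by
  decide +kernel

theorem search_zero : search (lamGt tLow) 20
    ((List.range 18).map fun k : ℕ => fixedDigit (0 + (-1 - k))) (fixedDigit (0 + 0))
    ((List.range 40).map fun k : ℕ => fixedDigit (0 + (1 + k))) = true := by
  decide +kernel

theorem lam_familySeq_zero_mem {γ : ℕ → ℕ} (hγ : ∀ n, γ n = 1 ∨ γ n = 2) :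
    lam (familySeq γ) 0 ∈ Ioo (tLow / 10 ^ 12 : ℝ) (tHigh / 10 ^ 12) := by
  have hw := familySeq_win γ (i := 0) (m := 18) (n := 40) (by norm_num)
  refine ⟨?_, hw.lt_of_lamLt (familySeq_pos hγ) lamLt_zero⟩
  by_contra hc
  exact Bool.false_ne_true ((hw.search_eq (a := -100) (b := 100)
    (fun j _ _ => familySeq_digit hγ j)
    (fun L c R _ _ h => Bool.eq_false_of_not_eq_true fun hn =>
      hc (h.gt_of_lamGt (familySeq_pos hγ) hn))
    (by simp) (by simp)).symm.trans search_zero)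

theorem lamLt_near : ∀ r < 22, r ≠ 4 → lamLt tLow
    ((List.range (r + 14)).map fun k : ℕ => fixedDigit ((r : ℕ) - 4 + (-1 - k)))
    (fixedDigit (r - 4 + 0))
    ((List.range 19).map fun k : ℕ => fixedDigit (r - 4 + (1 + k))) = true := by
  decide +kernel

theorem lam_familySeq_near {γ : ℕ → ℕ} (hγ : ∀ n, γ n = 1 ∨ γ n = 2) {i : ℤ} (h1 : -4 ≤ i)
    (h2 : i < 18) (h0 : i ≠ 0) : lam (familySeq γ) i < tLow / 10 ^ 12 := by
  obtain ⟨r, rfl⟩ : ∃ r : ℕ, i = r - 4 := ⟨(i + 4).toNat, by omega⟩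
  exact (familySeq_win γ (by push_cast; omega)).lt_of_lamLt (familySeq_pos hγ)
    (lamLt_near r (by omega) (by omega))

/-- Read leftwards from its centre, the window starts with a word of `Pwords`. -/
def startsPword (L : List ℕ) (c : ℕ) (_R : List ℕ) : Bool := Pwords.any (·.isPrefixOf (c :: L))

theorem Pwords_mismatch : ∀ w ∈ Pwords, ∀ k < 18, ∃ i < w.length, k + i < 24 ∧
    fixedDigit (5 - ((k + i : ℕ) : ℤ)) ≠ w.getD i 0 := by
  decide +kernel

theorem not_occursAtN_familySeq {γ : ℕ → ℕ} (hP : avoidsP (catSeq [1,1,2,2,1,1] γ)) {w : List ℕ}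
    (hw : w ∈ Pwords) (k : ℕ) : ¬ occursAtN w (fun n => familySeq γ (5 - n)) k := by
  intro h
  rcases lt_or_ge k 18 with hk | hk
  · obtain ⟨i, hi, hki, hne⟩ := Pwords_mismatch w hw k hk
    refine hne ?_
    rw [← h i hi]
    exact (familySeq_eq_fixedDigit γ (by omega)).symm
  · refine hP w hw ⟨k - 18, fun i hi => ?_⟩
    rw [← h i hi]
    beta_reduce
    rw [show (5 - ((k + i : ℕ) : ℤ)) = -1 - ((k - 18 + i + 12 : ℕ) : ℤ) by omega, familySeq_left]
    generalize k - 18 + i = n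
    rcases lt_or_ge n 6 with hn | hn
    · interval_cases n <;> rfl
    · have h1 : catSeq [1,1,2,2,1,1] γ n = γ (n - 6) := if_neg (Nat.not_lt.2 hn)
      have h2 : catSeq fixWord γ (n + 12) = γ (n + 12 - 18) :=
        if_neg (Nat.not_lt.2 (Nat.add_le_add_right hn 12))
      rw [h1, h2]
      congr 1

theorem startsPword_eq {γ : ℕ → ℕ} (hP : avoidsP (catSeq [1,1,2,2,1,1] γ)) (j : ℤ) (L : List ℕ)
    (c : ℕ) (R : List ℕ) (hj : j ≤ 5) (h : Win (familySeq γ) j L c R) :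
    startsPword L c R = false := by
  refine Bool.eq_false_of_not_eq_true fun hn => ?_
  simp [startsPword] at hn
  obtain ⟨w, hw, t, ht⟩ := hn
  refine not_occursAtN_familySeq hP hw (5 - j).toNat fun i hi => ?_
  have hi' : w.getD i 0 = (c :: L)[i]'(by rw [← ht]; simp; omega) := by
    simp only [← ht]
    rw [List.getElem_append_left hi, List.getD_eq_getElem _ _ hi]
  have hl : i < (c :: L).length := by rw [← ht]; simp; omega
  rw [hi']
  rcases i with _ | i
  · rw [List.getElem_cons_zero, ← h.center]
    beta_reduce
    congr 1
    omega
  · rw [List.getElem_cons_succ, ← h.left i _ (List.getElem?_eq_getElem (by simpa using hl))]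
    beta_reduce
    congr 1
    omega

/-- The test for positions far to the left. -/
def farTest (L : List ℕ) (c : ℕ) (R : List ℕ) : Bool :=
  lamLt tLow L c R ||
    Nat.ble R.length 10 && (scanRight startsPword L c R || scanLeft startsPword c R L)

theorem search_far : search farTest 21 [] 2 [] = true := by
  decide +kernel

theorem lam_familySeq_far {γ : ℕ → ℕ} (hγ : ∀ n, γ n = 1 ∨ γ n = 2)
    (hP : avoidsP (catSeq [1,1,2,2,1,1] γ)) {i : ℤ} (hi : i ≤ -5) :
    lam (familySeq γ) i < tLow / 10 ^ 12 := by
  rcases familySeq_digit hγ i with h1 | h2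
  · exact (Win.of_eq_nil h1).lt_of_lamLt (familySeq_pos hγ) lamLt_one
  · by_contra hc
    refine Bool.false_ne_true (((Win.of_eq_nil h2).search_eq (a := i - 100) (b := i + 100)
      (fun j _ _ => familySeq_digit hγ j) (fun L c R hL hR hw => ?_)
      ?_ ?_).symm.trans search_far)
    · have H : ∀ j L c R, i - 100 ≤ j → j ≤ 5 → Win (familySeq γ) j L c R →
          startsPword L c R = false := fun j L c R _ hj hw => startsPword_eq hP j L c R hj hw
      simp only [farTest, Bool.or_eq_false_iff, Bool.and_eq_false_iff]
      refine ⟨Bool.eq_false_of_not_eq_true fun hn => hc (hw.lt_of_lamLt (familySeq_pos hγ) hn),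
        ?_⟩
      rw [or_iff_not_imp_left, Bool.not_eq_false, Nat.ble_eq]
      intro h10
      exact ⟨hw.scanRight_eq H (by omega) (by omega), hw.scanLeft_eq H hL (by omega)⟩
    · simp only [List.length_nil]; omega
    · simp only [List.length_nil]; omega

theorem lam_familySeq_lt {γ : ℕ → ℕ} (hγ : ∀ n, γ n = 1 ∨ γ n = 2)
    (hP : avoidsP (catSeq [1,1,2,2,1,1] γ)) {i : ℤ} (hi : i ≠ 0) :
    lam (familySeq γ) i < tLow / 10 ^ 12 := by
  rcases le_or_gt i (-5) with h1 | h1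
  · exact lam_familySeq_far hγ hP h1
  · rcases lt_or_ge i 18 with h2 | h2
    · exact lam_familySeq_near hγ (by omega) h2 hi
    · refine lam_lt_of_eq_perZ (familySeq_pos hγ) (p := 0) fun n hn _ => ?_
      rw [familySeq_of_nonneg γ (by omega), sub_zero]

/-- a family of elements of `M \ L`. -/
theorem family_in_M_minus_L (γ : ℕ → ℕ) (hγ : ∀ n, γ n = 1 ∨ γ n = 2)
    (hP : avoidsP (catSeq [1,1,2,2,1,1] γ)) :
    cfVal (perSeq [2,2,2,2,1,1,2,2,1]) +
      cf0 (catSeq [1,2,2,1,1,2,2,2,2,1,2,2,1,1,2,2,1,1] γ) ∈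
    (MarkovSpectrum \ LagrangeSpectrum) ∩
      Ioo (3.118120178159 : ℝ) 3.118120178173 := by
  change cfVal (perSeq perWord) + cf0 (catSeq fixWord γ) ∈ _
  rw [← lam_familySeq_zero]
  have h0 := lam_familySeq_zero_mem hγ
  have hmax : IsGreatest (Set.range (lam (familySeq γ))) (lam (familySeq γ) 0) := by
    refine ⟨⟨0, rfl⟩, ?_⟩
    rintro _ ⟨i, rfl⟩
    rcases eq_or_ne i 0 with rfl | hi
    · exact le_rfl
    · exact ((lam_familySeq_lt hγ hP hi).trans h0.1).le
  refine ⟨⟨⟨_, familySeq_pos hγ, hmax.bddAbove, hmax.csSup_eq.symm⟩,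
    notMem_lagrangeSpectrum h0.1 h0.2⟩, ?_⟩
  have h1 := h0.1
  have h2 := h0.2
  norm_num [tLow, tHigh] at h1 h2
  norm_num
  exact ⟨h1, h2⟩
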